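/- Let F : U × ⋯ × U → K be an n-linear form (n ≥ 2) over a field K with a decomposition F = F' ⊕ 0, where F' has no zero direct summands and U = U' ⊕ U₀ is the corresponding decomposition of U. Then U₀ equals the set of all u ∈ U such that F(x₁,…,x_{i−1}, u, x_i,…,x_{n−1}) = 0 for every position i ∈ {1,…,n} and all x₁,…,x_{n−1} ∈ U. -/

import Mathlib

section Defs

variable {K : Type*} [Field K] {n : ℕ}

/-- The restriction of a multilinear form to a submodule. -/
def formRestrict {U : Type*} [AddCommGroup U] [Module K U]
    (F : MultilinearMap K (fun _ : Fin n => U) K) (W : Submodule K U) :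
    MultilinearMap K (fun _ : Fin n => W) K :=
  F.compLinearMap fun _ => W.subtype

/-- Two multilinear forms are congruent if a single linear bijection carries one to the other. -/
def FormCongruent {U V : Type*} [AddCommGroup U] [Module K U] [AddCommGroup V] [Module K V]
    (F : MultilinearMap K (fun _ : Fin n => U) K)
    (G : MultilinearMap K (fun _ : Fin n => V) K) : Prop :=
  ∃ φ : U ≃ₗ[K] V, ∀ u : Fin n → U, F u = G fun i => φ (u i)

/-- Symmetric equivalence of multilinear forms. -/
def FormSymmEquiv {U V : Type*} [AddCommGroup U] [Module K U] [AddCommGroup V] [Module K V]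
    (F : MultilinearMap K (fun _ : Fin n => U) K)
    (G : MultilinearMap K (fun _ : Fin n => V) K) : Prop :=
  ∃ φ : Fin n → U ≃ₗ[K] V, ∀ (σ : Equiv.Perm (Fin n)) (u : Fin n → U),
    F u = G fun i => φ (σ i) (u i)

/-- `W` is a direct-sum decomposition of the underlying space for which `F` vanishes on
mixed tuples, i.e. `F = ⨁ᵢ F|Wᵢ`. -/
def IsDecompFamily {U : Type*} [AddCommGroup U] [Module K U] {ι : Type*} [DecidableEq ι]
    (F : MultilinearMap K (fun _ : Fin n => U) K) (W : ι → Submodule K U) : Prop :=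
  DirectSum.IsInternal W ∧
    ∀ (x : Fin n → U) (k l : Fin n) (i j : ι), i ≠ j → x k ∈ W i → x l ∈ W j → F x = 0

/-- A multilinear form is indecomposable if in every direct-sum decomposition one of the
two subspaces is zero. -/
def FormIndecomposable {U : Type*} [AddCommGroup U] [Module K U]
    (F : MultilinearMap K (fun _ : Fin n => U) K) : Prop :=
  ∀ W₁ W₂ : Submodule K U, IsCompl W₁ W₂ →
    (∀ (x : Fin n → U) (k l : Fin n), x k ∈ W₁ → x l ∈ W₂ → F x = 0) →
    W₁ = ⊥ ∨ W₂ = ⊥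

/-- A multilinear form has no zero direct summands if in every direct-sum decomposition the
summand that is the zero form corresponds to the zero subspace. -/
def FormNoZeroSummand {U : Type*} [AddCommGroup U] [Module K U]
    (F : MultilinearMap K (fun _ : Fin n => U) K) : Prop :=
  ∀ W₁ W₂ : Submodule K U, IsCompl W₁ W₂ →
    (∀ (x : Fin n → U) (k l : Fin n), x k ∈ W₁ → x l ∈ W₂ → F x = 0) →
    (∀ x : Fin n → U, (∀ k, x k ∈ W₂) → F x = 0) → W₂ = ⊥

/-- A linear map `τ` is `G`-selfadjoint if applying `τ` in any one argument of `G`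
gives the same value regardless of the argument chosen. -/
def FormSelfAdjoint {V : Type*} [AddCommGroup V] [Module K V]
    (G : MultilinearMap K (fun _ : Fin n => V) K) (τ : V →ₗ[K] V) : Prop :=
  ∀ (v : Fin n → V) (i j : Fin n),
    G (Function.update v i (τ (v i))) = G (Function.update v j (τ (v j)))

end Defs

/-- The radical of a multilinear form: the vectors `u` such that the form vanishes whenever `u` is
inserted in any one position. -/
def formRadical {K : Type*} [Field K] {n : ℕ} {U : Type*} [AddCommGroup U] [Module K U]
    (F : MultilinearMap K (fun _ : Fin n => U) K) : Submodule K U where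
  carrier := {u : U | ∀ (x : Fin n → U) (k : Fin n), F (Function.update x k u) = 0}
  zero_mem' := fun x k => F.map_update_zero x k
  add_mem' := fun {u v} hu hv x k => by rw [F.map_update_add, hu, hv, add_zero]
  smul_mem' := fun c u hu x k => by rw [F.map_update_smul, hu, smul_zero]

theorem map_eq_zero_of_mem_formRadical {K : Type*} [Field K] {n : ℕ} {U : Type*}
    [AddCommGroup U] [Module K U] {F : MultilinearMap K (fun _ : Fin n => U) K}
    {x : Fin n → U} {k : Fin n} (hx : x k ∈ formRadical F) : F x = 0 := by
  simpa using hx x k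

/-- A form in at least one argument without zero direct summands has zero radical. -/
theorem FormNoZeroSummand.formRadical_eq_bot {K : Type*} [Field K] {n : ℕ} (hn : 0 < n)
    {U : Type*} [AddCommGroup U] [Module K U] {F : MultilinearMap K (fun _ : Fin n => U) K}
    (hF : FormNoZeroSummand F) : formRadical F = ⊥ := by
  obtain ⟨W, hW⟩ := (formRadical F).exists_isCompl
  exact hF W (formRadical F) hW.symm
    (fun _ _ _ _ hl => map_eq_zero_of_mem_formRadical hl)
    (fun _ hx => map_eq_zero_of_mem_formRadical (hx ⟨0, hn⟩))

/-- A zero direct summand of a form is contained in the radical. -/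
theorem le_formRadical_of_isCompl {K : Type*} [Field K] {n : ℕ}
    {U : Type*} [AddCommGroup U] [Module K U] {F : MultilinearMap K (fun _ : Fin n => U) K}
    {U' U₀ : Submodule K U} (hU : IsCompl U' U₀)
    (hmix : ∀ (x : Fin n → U) (k l : Fin n), x k ∈ U' → x l ∈ U₀ → F x = 0)
    (hzero : ∀ x : Fin n → U, (∀ k, x k ∈ U₀) → F x = 0) : U₀ ≤ formRadical F := by
  intro u hu x k
  have hdec (v : U) : ∃ a ∈ U', ∃ b ∈ U₀, a + b = v :=
    Submodule.mem_sup.mp (hU.sup_eq_top ▸ Submodule.mem_top)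
  choose a ha b hb hab using fun i => hdec (x i)
  have hx : Function.update x k u = Function.update a k 0 + Function.update b k u := by
    ext i
    rcases eq_or_ne i k with rfl | hi
    · simp
    · simp [hi, hab]
  rw [hx, F.map_add_univ]
  refine Finset.sum_eq_zero fun s _ => ?_
  have ha' (i : Fin n) : Function.update a k 0 i ∈ U' := by
    rcases eq_or_ne i k with rfl | hi
    · simp
    · simpa [hi] using ha i
  have hb' (i : Fin n) : Function.update b k u i ∈ U₀ := by
    rcases eq_or_ne i k with rfl | hi
    · simpa using hu
    · simpa [hi] using hb i
  rcases s.eq_empty_or_nonempty with rfl | ⟨l, hl⟩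
  · exact hzero _ fun i => by simpa using hb' i
  · refine hmix _ l k (by simpa [hl] using ha' l) ?_
    by_cases hk : k ∈ s
    · simp [hk]
    · simpa [hk] using hu

/-- If `F = F' ⊕ 0` with `F'` having no zero direct summands and `U = U' ⊕ U₀`, then `U₀` is
exactly the set of vectors `u` such that `F` vanishes whenever `u` is inserted in any one
position, the remaining arguments being arbitrary. -/
theorem stmt_14 {K : Type*} [Field K] {n : ℕ} (hn : 2 ≤ n)
    {U : Type*} [AddCommGroup U] [Module K U] [FiniteDimensional K U]
    (F : MultilinearMap K (fun _ : Fin n => U) K)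
    (U' U₀ : Submodule K U)
    (hU : IsCompl U' U₀)
    (hUmix : ∀ (x : Fin n → U) (k l : Fin n), x k ∈ U' → x l ∈ U₀ → F x = 0)
    (hU0 : ∀ x : Fin n → U, (∀ k, x k ∈ U₀) → F x = 0)
    (hUnz : FormNoZeroSummand (formRestrict F U')) :
    (U₀ : Set U) =
      {u : U | ∀ (x : Fin n → U) (k : Fin n), F (Function.update x k u) = 0} := by
  have hle := le_formRadical_of_isCompl hU hUmix hU0
  refine Set.Subset.antisymm (fun u hu => hle hu) fun u hu => ?_
  obtain ⟨a, ha, b, hb, rfl⟩ : ∃ a ∈ U', ∃ b ∈ U₀, a + b = u :=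
    Submodule.mem_sup.mp (hU.sup_eq_top ▸ Submodule.mem_top)
  have har : a ∈ formRadical F :=
    ((formRadical F).add_mem_iff_left (hle hb)).mp hu
  have har' : (⟨a, ha⟩ : U') ∈ formRadical (formRestrict F U') := fun x k =>
    map_eq_zero_of_mem_formRadical (F := F)
      (x := fun i => (Function.update x k ⟨a, ha⟩ i : U)) (k := k) (by simpa using har)
  rw [hUnz.formRadical_eq_bot (by omega), Submodule.mem_bot, Submodule.mk_eq_zero] at har'
  simpa [har'] using hb
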